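/- Let 𝐬 = ([i_1,j_1],…,[i_r,j_r]) ∈ 𝐒ˢ be prime with r ≥ 3, N = N(𝐬), ξ = ξ_𝐬, s_m = p_{r−m+1}, and set i'_{s_m} = (ξ(s_m) − s_m)/2 − ε_m and j'_{s_m} = (ξ(s_m) + s_m)/2 − ε_m for 1 ≤ m ≤ r. Then min_{1≤m≤r} j'_{s_m} = max_{1≤m≤r} i'_{s_m} and max_{1≤m≤r} j'_{s_m} − min_{1≤m≤r} i'_{s_m} = N + 1. -/

import Mathlib

/-- The interval `[a,b]` belongs to `𝕀ₙ` (integer intervals with `0 ≤ b - a ≤ n+1`). -/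
def InIntv (n : ℕ) (a b : ℤ) : Prop := 0 ≤ b - a ∧ b - a ≤ (n : ℤ) + 1

/-- `([i 1, j 1], …, [i r, j r])` together with signs `ε 1, …, ε r ∈ {0,1}` is a
stable alternating snake of sink–source type (`𝐬 ∈ 𝐒ˢ`). -/
def IsSnake (n r : ℕ) (i j : ℕ → ℤ) (ε : ℕ → ℕ) : Prop :=
  (∀ s, 1 ≤ s → s ≤ r → InIntv n (i s) (j s)) ∧
  (∀ s, 1 ≤ s → s ≤ r → ε s ≤ 1) ∧
  (∀ s p, 1 ≤ s → s < p → p ≤ r → ¬(i s = i p ∧ j s = j p)) ∧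
  (∀ p, 1 ≤ p → p + 1 ≤ r →
    ε p + ε (p + 1) = 1 ∧ i (p + 1 - ε p) < i (p + ε p) ∧ j (p + 1 - ε p) < j (p + ε p)) ∧
  (∀ p s, 1 ≤ p → p + 2 ≤ s → s ≤ r → i p ≤ i s ∧ i s < j s ∧ j s ≤ j p)

/-- The snake `𝐬` is connected. -/
def IsConnectedSnake (n r : ℕ) (i j : ℕ → ℤ) (ε : ℕ → ℕ) : Prop :=
  IsSnake n r i j ε ∧
  ∀ p, 1 ≤ p → p + 1 ≤ r →
    i (p + 1 - ε p) < i (p + ε p) ∧ i (p + ε p) ≤ j (p + 1 - ε p) ∧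
      j (p + 1 - ε p) < j (p + ε p) ∧ j (p + ε p) - i (p + 1 - ε p) ≤ (n : ℤ) + 1

/-- The snake `𝐬` is prime. -/
def IsPrimeSnake (n r : ℕ) (i j : ℕ → ℤ) (ε : ℕ → ℕ) : Prop :=
  IsConnectedSnake n r i j ε ∧
  ∀ s, 1 ≤ s → s + 2 ≤ r → i s ≠ i (s + 2) ∧ j s ≠ j (s + 2)

/-- `N(𝐬) = r + #{2 ≤ s ≤ r-2 : i (s-1) ≠ i (s+2) and j (s-1) ≠ j (s+2)}`. -/
def Nval (r : ℕ) (i j : ℕ → ℤ) : ℕ :=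
  r + ((Finset.Icc 2 (r - 2)).filter
    (fun s => i (s - 1) ≠ i (s + 2) ∧ j (s - 1) ≠ j (s + 2))).card

/-- The sequence `p_1, …, p_r` attached to a prime snake:
`p 1 = 1`, `p 2 = 2`, `p r = p (r-1) + 1`, and for `2 ≤ m ≤ r-2`,
`p (m+1) = p m + 2` if `i (r-m+2) ≠ i (r-m-1)` and `j (r-m+2) ≠ j (r-m-1)`,
and `p (m+1) = p m + 1` otherwise. -/
def pSeq (r : ℕ) (i j : ℕ → ℤ) : ℕ → ℕ
  | 0 => 0
  | 1 => 1
  | 2 => 2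
  | m + 3 =>
    pSeq r i j (m + 2) +
      (if m + 3 = r then 1
       else if i (r - m) ≠ i (r - m - 3) ∧ j (r - m) ≠ j (r - m - 3) then 2 else 1)

/-- The defining conditions of the height function `ξ = ξ_𝐬 : {1,…,N} → ℤ`. -/
def HeightCond (r N : ℕ) (p ε : ℕ → ℕ) (ξ : ℕ → ℤ) : Prop :=
  (∀ t, 1 ≤ t → t + 1 ≤ N → |ξ (t + 1) - ξ t| ≤ 1) ∧
  ξ (p r) = (p r : ℤ) ∧
  (∀ m, 1 ≤ m → m ≤ r → 2 ≤ p m → p m + 1 ≤ N → ξ (p m - 1) = ξ (p m + 1)) ∧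
  (∀ m, 1 ≤ m → m + 1 ≤ r →
    ξ (p (m + 1 - ε (r - m))) - ξ (p (m + ε (r - m))) = (p (m + 1) : ℤ) - (p m : ℤ))

/-- `s_m = p_{r-m+1}`. -/
def sIdx (r : ℕ) (i j : ℕ → ℤ) (m : ℕ) : ℕ := pSeq r i j (r - m + 1)

/-- `i'_{s_m} = (ξ(s_m) - s_m)/2 - ε_m`. -/
def iPr (r : ℕ) (i j : ℕ → ℤ) (ε : ℕ → ℕ) (ξ : ℕ → ℤ) (m : ℕ) : ℤ :=
  (ξ (sIdx r i j m) - (sIdx r i j m : ℤ)) / 2 - (ε m : ℤ)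

/-- `j'_{s_m} = (ξ(s_m) + s_m)/2 - ε_m`. -/
def jPr (r : ℕ) (i j : ℕ → ℤ) (ε : ℕ → ℕ) (ξ : ℕ → ℤ) (m : ℕ) : ℤ :=
  (ξ (sIdx r i j m) + (sIdx r i j m : ℤ)) / 2 - (ε m : ℤ)

/-- Partial count: before the last step, `p` is shifted by the number of double steps so far. -/
theorem pSeq_eq_add_card {r : ℕ} (i j : ℕ → ℤ) (m : ℕ) (hm : m + 3 ≤ r) :
    pSeq r i j (m + 2) = m + 2 + ((Finset.Icc (r - m - 1) (r - 2)).filter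
      (fun s => i (s - 1) ≠ i (s + 2) ∧ j (s - 1) ≠ j (s + 2))).card := by
  induction m with
  | zero =>
    rw [Finset.Icc_eq_empty (by omega)]
    rfl
  | succ m ih =>
    have hIcc : Finset.Icc (r - (m + 1) - 1) (r - 2) =
        insert (r - m - 2) (Finset.Icc (r - m - 1) (r - 2)) := by
      ext x
      simp only [Finset.mem_Icc, Finset.mem_insert]
      omega
    have hnot : r - m - 2 ∉ Finset.Icc (r - m - 1) (r - 2) := by
      simp only [Finset.mem_Icc]
      omega
    have hlow : r - m - 2 - 1 = r - m - 3 := by omega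
    have hhigh : r - m - 2 + 2 = r - m := by omega
    rw [show m + 1 + 2 = m + 3 from rfl, pSeq, ih (by omega), if_neg (by omega), hIcc,
      Finset.filter_insert, hlow, hhigh]
    by_cases h : i (r - m) ≠ i (r - m - 3) ∧ j (r - m) ≠ j (r - m - 3)
    · rw [if_pos h, if_pos ⟨h.1.symm, h.2.symm⟩, Finset.card_insert_of_notMem (by simp [hnot])]
      omega
    · rw [if_neg h, if_neg (fun h' => h ⟨h'.1.symm, h'.2.symm⟩)]
      omega

theorem pSeq_last {r : ℕ} (hr : 3 ≤ r) (i j : ℕ → ℤ) : pSeq r i j r = Nval r i j := by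
  obtain ⟨m, rfl⟩ := Nat.exists_eq_add_of_le' hr
  have h := pSeq_eq_add_card (r := m + 3) i j m le_rfl
  rw [show m + 3 - m - 1 = 2 by omega] at h
  rw [pSeq, if_pos rfl, h, Nval]
  omega

theorem pSeq_lt_succ (r : ℕ) (i j : ℕ → ℤ) (m : ℕ) : pSeq r i j m < pSeq r i j (m + 1) := by
  match m with
  | 0 => simp [pSeq]
  | 1 => simp [pSeq]
  | m + 2 =>
    rw [pSeq]
    split_ifs <;> omega

theorem sIdx_succ_lt {r : ℕ} (i j : ℕ → ℤ) {q : ℕ} (hqr : q + 1 ≤ r) :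
    sIdx r i j (q + 1) < sIdx r i j q := by
  have h := pSeq_lt_succ r i j (r - q)
  rwa [sIdx, sIdx, show r - (q + 1) + 1 = r - q by omega]

theorem HeightCond.sIdx_step {r N : ℕ} {i j : ℕ → ℤ} {ε : ℕ → ℕ} {ξ : ℕ → ℤ}
    (hξ : HeightCond r N (pSeq r i j) ε ξ) {q : ℕ} (hq : 1 ≤ q) (hqr : q + 1 ≤ r) :
    (ε q = 0 → ξ (sIdx r i j q) - ξ (sIdx r i j (q + 1)) =
      (sIdx r i j q : ℤ) - sIdx r i j (q + 1)) ∧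
    (ε q = 1 → ξ (sIdx r i j (q + 1)) - ξ (sIdx r i j q) =
      (sIdx r i j q : ℤ) - sIdx r i j (q + 1)) := by
  have h := hξ.2.2.2 (r - q) (by omega) (by omega)
  rw [show r - (r - q) = q by omega] at h
  unfold sIdx
  rw [show r - (q + 1) + 1 = r - q by omega]
  constructor <;> intro hε <;> rw [hε] at h <;> simpa using h

/-- A sequence increasing on `{1, …, r}` takes its values between its end values. -/
theorem mem_Icc_ends_of_le_succ {r : ℕ} {f : ℕ → ℤ}
    (hf : ∀ q, 1 ≤ q → q + 1 ≤ r → f q ≤ f (q + 1)) {m : ℕ} (hm : 1 ≤ m) (hmr : m ≤ r) :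
    f 1 ≤ f m ∧ f m ≤ f r := by
  constructor
  · induction m, hm using Nat.le_induction with
    | base => exact le_rfl
    | succ q hq ih => exact (ih (by omega)).trans (hf q hq hmr)
  · induction r, hmr using Nat.le_induction with
    | base => exact le_rfl
    | succ q hq ih =>
      exact (ih fun t ht htq => hf t ht (by omega)).trans (hf q (by omega) le_rfl)

/-- `min j'_{s_m} = max i'_{s_m}` and `max j'_{s_m} - min i'_{s_m} = N + 1`. -/
theorem stmt17 (n r : ℕ) (hn : 1 ≤ n) (hr : 3 ≤ r) (i j : ℕ → ℤ) (ε : ℕ → ℕ)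
    (hp : IsPrimeSnake n r i j ε)
    (ξ : ℕ → ℤ) (hξ : HeightCond r (Nval r i j) (pSeq r i j) ε ξ) :
    (∃ a : ℤ, IsGreatest {x | ∃ m, 1 ≤ m ∧ m ≤ r ∧ x = iPr r i j ε ξ m} a ∧
      IsLeast {x | ∃ m, 1 ≤ m ∧ m ≤ r ∧ x = jPr r i j ε ξ m} a) ∧
    (∃ c d : ℤ, IsGreatest {x | ∃ m, 1 ≤ m ∧ m ≤ r ∧ x = jPr r i j ε ξ m} c ∧
      IsLeast {x | ∃ m, 1 ≤ m ∧ m ≤ r ∧ x = iPr r i j ε ξ m} d ∧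
      c - d = (Nval r i j : ℤ) + 1) := by
  obtain ⟨⟨⟨-, hε1, -, halt, -⟩, -⟩, -⟩ := hp
  have hstep := fun q (hq : 1 ≤ q) (hqr : q + 1 ≤ r) => hξ.sIdx_step hq hqr
  have hlt := fun q (hqr : q + 1 ≤ r) => sIdx_succ_lt i j hqr
  have hfirst : sIdx r i j 1 = Nval r i j := by
    rw [sIdx, Nat.sub_add_cancel (by omega), pSeq_last hr]
  have hlast : sIdx r i j r = 1 := by simp [sIdx, pSeq]
  have hξfirst : ξ (sIdx r i j 1) = sIdx r i j 1 := by
    rw [hfirst, ← pSeq_last hr, hξ.2.1]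
  have hε : ∀ m, 1 ≤ m → m ≤ r → ε m = 0 ∨ ε m = 1 := fun m h1 h2 => by
    have := hε1 m h1 h2
    omega
  have hsum : ∀ q, 1 ≤ q → q + 1 ≤ r → ε q + ε (q + 1) = 1 := fun q h1 h2 => (halt q h1 h2).1
  have hparity : ∀ m, 1 ≤ m → m ≤ r →
      (ξ (sIdx r i j m) - (sIdx r i j m : ℤ)) % 2 = 0 := by
    intro m hm
    induction m, hm using Nat.le_induction with
    | base => intro _; omega
    | succ q hq ih =>
      intro hqr
      have := ih (by omega)
      have := hstep q hq hqr
      rcases hε q hq (by omega) with h | h <;> omega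
  let I : ℕ → ℤ := fun m => (ξ (sIdx r i j m) - (sIdx r i j m : ℤ)) / 2
  let J : ℕ → ℤ := fun m => (ξ (sIdx r i j m) + (sIdx r i j m : ℤ)) / 2
  have hiPr : ∀ m, iPr r i j ε ξ m = I m - ε m := fun _ => rfl
  have hjPr : ∀ m, jPr r i j ε ξ m = J m - ε m := fun _ => rfl
  have hI0 : ∀ q, 1 ≤ q → q + 1 ≤ r → ε q = 0 → I q = I (q + 1) := by
    intro q hq hqr h
    have := (hstep q hq hqr).1 h
    simp only [I]
    omega
  have hJ1 : ∀ q, 1 ≤ q → q + 1 ≤ r → ε q = 1 → J q = J (q + 1) := by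
    intro q hq hqr h
    have := (hstep q hq hqr).2 h
    simp only [J]
    omega
  have hI : ∀ q, 1 ≤ q → q + 1 ≤ r → I q ≤ I (q + 1) := by
    intro q hq hqr
    have := hstep q hq hqr
    have := hlt q hqr
    simp only [I]
    rcases hε q hq (by omega) with h | h <;> omega
  have hJ : ∀ q, 1 ≤ q → q + 1 ≤ r → -J q ≤ -J (q + 1) := by
    intro q hq hqr
    have := hstep q hq hqr
    have := hlt q hqr
    simp only [J]
    rcases hε q hq (by omega) with h | h <;> omega
  have hIm := fun m (hm : 1 ≤ m) (hmr : m ≤ r) => mem_Icc_ends_of_le_succ hI hm hmr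
  have hJm := fun m (hm : 1 ≤ m) (hmr : m ≤ r) =>
    mem_Icc_ends_of_le_succ (f := fun q => -J q) hJ hm hmr
  have hJr : J r = I r + 1 := by
    simp only [I, J, hlast]
    omega
  have hJI : J 1 - I 1 = Nval r i j := by
    simp only [I, J, hξfirst, ← hfirst]
    omega
  have hr1 : r - 1 + 1 = r := by omega
  have hI0r := hI0 (r - 1) (by omega) (by omega)
  have hJ1r := hJ1 (r - 1) (by omega) (by omega)
  have hsumr := hsum (r - 1) (by omega) (by omega)
  have hI01 := hI0 1 le_rfl (by omega)
  have hJ11 := hJ1 1 le_rfl (by omega)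
  have hsum1 := hsum 1 le_rfl (by omega)
  rw [hr1] at hI0r hJ1r hsumr
  rw [one_add_one_eq_two] at hI01 hJ11 hsum1
  refine ⟨⟨I r, ⟨?_, ?_⟩, ?_, ?_⟩, J 1, I 1 - 1, ⟨?_, ?_⟩, ⟨?_, ?_⟩, by omega⟩
  · rcases hε r (by omega) le_rfl with h | h
    · exact ⟨r, by omega, le_rfl, by rw [hiPr]; omega⟩
    · exact ⟨r - 1, by omega, by omega, by rw [hiPr]; omega⟩
  · rintro _ ⟨m, hm, hmr, rfl⟩
    have := hIm m hm hmr
    rw [hiPr]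
    omega
  · rcases hε r (by omega) le_rfl with h | h
    · exact ⟨r - 1, by omega, by omega, by rw [hjPr]; omega⟩
    · exact ⟨r, by omega, le_rfl, by rw [hjPr]; omega⟩
  · rintro _ ⟨m, hm, hmr, rfl⟩
    have := hJm m hm hmr
    have := hε m hm hmr
    rw [hjPr]
    omega
  · rcases hε 1 le_rfl (by omega) with h | h
    · exact ⟨1, le_rfl, by omega, by rw [hjPr]; omega⟩
    · exact ⟨2, by omega, by omega, by rw [hjPr]; omega⟩
  · rintro _ ⟨m, hm, hmr, rfl⟩
    have := hJm m hm hmr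
    rw [hjPr]
    omega
  · rcases hε 1 le_rfl (by omega) with h | h
    · exact ⟨2, by omega, by omega, by rw [hiPr]; omega⟩
    · exact ⟨1, le_rfl, by omega, by rw [hiPr]; omega⟩
  · rintro _ ⟨m, hm, hmr, rfl⟩
    have := hIm m hm hmr
    have := hε m hm hmr
    rw [hiPr]
    omega
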